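/- arXiv:2503.19203 — 6 statements merged into one kernel-verified Lean document; each statement's English description precedes it below -/
import Mathlib

section
/- Let η > 0 and let p_∞(x) = (2^{2/η²} η^{1−4/η²} / Γ(2/η²)) · exp(−(2/η²)·1/(1+ηx)) · (1+ηx)^{−2−2/η²} for x > −1/η. Then the function x ↦ x·p_∞(x) is integrable on (−1/η, ∞) and ∫_{−1/η}^{∞} x·p_∞(x) dx = 0. -/
theorem stmt3 (η : ℝ) (hη : 0 < η)
    (p : ℝ → ℝ)
    (hp : ∀ x : ℝ, x > -1 / η →
      p x = (2 : ℝ) ^ (2 / η ^ 2) * η ^ (1 - 4 / η ^ 2) / Real.Gamma (2 / η ^ 2) *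
        (Real.exp (-(2 / η ^ 2) * (1 / (1 + η * x))) * (1 + η * x) ^ (-2 - 2 / η ^ 2))) :
    MeasureTheory.IntegrableOn (fun x => x * p x) (Set.Ioi (-1 / η)) ∧
    ∫ x in Set.Ioi (-1 / η), x * p x = 0 := by
  generalize (2 : ℝ) ^ (2 / η ^ 2) * η ^ (1 - 4 / η ^ 2) / Real.Gamma (2 / η ^ 2) = C at hp
  obtain ⟨a, ha⟩ : ∃ a : ℝ, a = 2 / η ^ 2 := ⟨_, rfl⟩
  rw [← ha] at hp
  have ha0 : 0 < a := by rw [ha]; positivity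
  have haη : a * η ^ 2 = 2 := by rw [ha]; field_simp
  have hneg : -1 / η < 0 := by
    rw [neg_div]; exact neg_lt_zero.mpr (by positivity)
  have hu : ∀ x : ℝ, -1 / η < x → 0 < 1 + η * x := by
    intro x hx
    rw [div_lt_iff₀ hη] at hx
    linarith
  set f : ℝ → ℝ := fun x => x * (Real.exp (-a * (1 / (1 + η * x))) * (1 + η * x) ^ (-2 - a)) with hf
  set G : ℝ → ℝ := fun x => -(1 / 2) * (Real.exp (-a * (1 / (1 + η * x))) * (1 + η * x) ^ (-a)) with hG
  have hend : 1 + η * (-1 / η) = 0 := by field_simp; ring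
  have hGend : G (-1 / η) = 0 := by
    simp only [hG, hend]
    rw [Real.zero_rpow (by linarith)]; ring
  have hderiv : ∀ x ∈ Set.Ioi (-1 / η), HasDerivAt G (f x) x := by
    intro x hx
    have hux := hu x hx
    have h1 : HasDerivAt (fun x : ℝ => 1 + η * x) η x := by
      simpa using ((hasDerivAt_id x).const_mul η).const_add 1
    have h2 := (((h1.inv hux.ne').const_mul (-a)).exp.mul
      (h1.rpow_const (p := -a) (Or.inl hux.ne'))).const_mul (-(1 / 2) : ℝ)
    have e1 : (1 + η * x) ^ (-a) = (1 + η * x) ^ (-2 - a) * (1 + η * x) ^ 2 := by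
      rw [← Real.rpow_natCast, ← Real.rpow_add hux]; congr 1; push_cast; ring
    have e2 : (1 + η * x) ^ (-a - 1) = (1 + η * x) ^ (-2 - a) * (1 + η * x) := by
      nth_rewrite 3 [← Real.rpow_one (1 + η * x)]
      rw [← Real.rpow_add hux]; congr 1; ring
    refine (h2.congr_deriv ?_).congr_of_eventuallyEq ?_
    · simp only [hf, one_div, Pi.inv_apply]
      rw [e1, e2]
      generalize (1 + η * x) ^ (-2 - a) = R
      generalize Real.exp (-a * (1 + η * x)⁻¹) = E
      field_simp
      linear_combination (x * E * R) * haη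
    · refine Filter.Eventually.of_forall fun y => ?_
      simp [hG]
  have hlim0 : Filter.Tendsto G (nhdsWithin (-1 / η) (Set.Ioi (-1 / η))) (nhds 0) := by
    have h1 := tendsto_rpow_mul_exp_neg_mul_atTop_nhds_zero a a ha0
    have h2 : Filter.Tendsto (fun x : ℝ => 1 + η * x) (nhdsWithin (-1 / η) (Set.Ioi (-1 / η)))
        (nhdsWithin 0 (Set.Ioi 0)) := by
      refine tendsto_nhdsWithin_iff.mpr ⟨?_, ?_⟩
      · have : Continuous (fun x : ℝ => 1 + η * x) := by fun_prop
        have := this.tendsto (-1 / η)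
        rw [hend] at this
        exact this.mono_left nhdsWithin_le_nhds
      · filter_upwards [self_mem_nhdsWithin] with x hx using hu x hx
    have h3 := ((h1.comp tendsto_inv_nhdsGT_zero).comp h2).const_mul (-(1 / 2) : ℝ)
    rw [mul_zero] at h3
    refine h3.congr' ?_
    filter_upwards [self_mem_nhdsWithin] with x hx
    have := hu x hx
    simp only [hG, Function.comp, one_div]
    rw [Real.inv_rpow this.le, Real.rpow_neg this.le]; ring
  have hcont : ContinuousWithinAt G (Set.Ici (-1 / η)) (-1 / η) := by
    rw [← continuousWithinAt_Ioi_iff_Ici]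
    unfold ContinuousWithinAt
    rwa [hGend]
  have hinf : Filter.Tendsto G Filter.atTop (nhds 0) := by
    have h2 : Filter.Tendsto (fun x : ℝ => 1 + η * x) Filter.atTop Filter.atTop :=
      Filter.tendsto_atTop_add_const_left _ _ (Filter.tendsto_id.const_mul_atTop hη)
    have h3 := (tendsto_rpow_neg_atTop ha0).comp h2
    have h4 := (Real.continuous_exp.tendsto _).comp ((tendsto_inv_atTop_zero.comp h2).const_mul (-a))
    have h5 := (h4.mul h3).const_mul (-(1 / 2) : ℝ)
    simp only [mul_zero] at h5
    refine h5.congr fun x => ?_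
    simp [hG]
  have hi1 : MeasureTheory.IntegrableOn f (Set.Ioi 0) := by
    refine MeasureTheory.integrableOn_Ioi_deriv_of_nonneg
      (hderiv 0 hneg).continuousAt.continuousWithinAt
      (fun x hx => hderiv x (hneg.trans hx)) (fun x hx => ?_) hinf
    have := hu x (hneg.trans hx)
    have hx' : 0 < x := hx
    simp only [hf]; positivity
  have hi2 : MeasureTheory.IntegrableOn f (Set.Ioc (-1 / η) 0) := by
    have : MeasureTheory.IntegrableOn (fun x => -f x) (Set.Ioc (-1 / η) 0) := by
      refine intervalIntegral.integrableOn_deriv_of_nonneg (g := fun x => -G x) ?_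
        (fun x hx => (hderiv x hx.1).neg) (fun x hx => ?_)
      · refine ContinuousOn.neg fun x hx => ?_
        rcases hx.1.eq_or_lt with h | h
        · subst h
          exact hcont.mono Set.Icc_subset_Ici_self
        · exact (hderiv x h).continuousAt.continuousWithinAt
      · have := hu x hx.1
        have hx' : 0 ≤ -x := by linarith [hx.2]
        simp only [hf]; rw [← neg_mul]; positivity
    simpa using this.neg
  have hi : MeasureTheory.IntegrableOn f (Set.Ioi (-1 / η)) := by
    rw [← Set.Ioc_union_Ioi_eq_Ioi hneg.le]
    exact hi2.union hi1
  have heq : Set.EqOn (fun x => C * f x) (fun x => x * p x) (Set.Ioi (-1 / η)) := by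
    intro x hx
    simp only [hf]
    rw [hp x hx]; ring
  refine ⟨(MeasureTheory.integrableOn_congr_fun heq measurableSet_Ioi).mp (hi.const_mul C), ?_⟩
  rw [← MeasureTheory.setIntegral_congr_fun measurableSet_Ioi heq,
    MeasureTheory.integral_const_mul,
    MeasureTheory.integral_Ioi_of_hasDerivAt_of_tendsto hcont hderiv hi hinf, hGend]
  simp
end

section
/- Let η be real with 0 < η < √2, and let p_∞(x) = (2^{2/η²} η^{1−4/η²} / Γ(2/η²)) · exp(−(2/η²)·1/(1+ηx)) · (1+ηx)^{−2−2/η²} for x > −1/η. Then the function x ↦ x²·p_∞(x) is integrable on (−1/η, ∞) and ∫_{−1/η}^{∞} x²·p_∞(x) dx = 1/(2−η²). -/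
theorem stmt4_aux (a : ℝ) (ha : 1 < a) :
    MeasureTheory.IntegrableOn
      (fun t : ℝ => t ^ (a - 2) * (1 - t) ^ 2 * Real.exp (-(a * t))) (Set.Ioi 0) ∧
    ∫ t in Set.Ioi (0 : ℝ), t ^ (a - 2) * (1 - t) ^ 2 * Real.exp (-(a * t))
      = (1 / a) ^ a * Real.Gamma a / (a - 1) := by
  have ha0 : 0 < a := by linarith
  have hint : ∀ s : ℝ, 0 < s → MeasureTheory.IntegrableOn
      (fun t : ℝ => t ^ (s - 1) * Real.exp (-(a * t))) (Set.Ioi 0) := by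
    intro s hs
    have h := integrableOn_rpow_mul_exp_neg_mul_rpow (p := 1) (s := s - 1) (b := a)
      (by linarith) one_pos ha0
    refine h.congr_fun (fun t _ => ?_) measurableSet_Ioi
    simp
  have hval : ∀ s : ℝ, 0 < s → ∫ t in Set.Ioi (0 : ℝ), t ^ (s - 1) * Real.exp (-(a * t))
      = (1 / a) ^ s * Real.Gamma s := fun s hs => Real.integral_rpow_mul_exp_neg_mul_Ioi hs ha0
  have h1 := hint (a - 1) (by linarith)
  have h2 := (hint a ha0).const_mul 2
  have h3 := hint (a + 1) (by linarith)
  have heq : Set.EqOn (fun t : ℝ => t ^ (a - 1 - 1) * Real.exp (-(a * t))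
      - 2 * (t ^ (a - 1) * Real.exp (-(a * t))) + t ^ (a + 1 - 1) * Real.exp (-(a * t)))
      (fun t : ℝ => t ^ (a - 2) * (1 - t) ^ 2 * Real.exp (-(a * t))) (Set.Ioi 0) := by
    intro t ht
    have ht : 0 < t := ht
    have e0 : a - 1 - 1 = a - 2 := by ring
    have e1 : t ^ (a - 1) = t ^ (a - 2) * t := by
      rw [← Real.rpow_add_one ht.ne']; congr 1; ring
    have e2 : t ^ (a + 1 - 1) = t ^ (a - 2) * t * t := by
      rw [← e1, ← Real.rpow_add_one ht.ne']; congr 1; ring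
    simp only [e0, e1, e2]
    ring
  have h12 : MeasureTheory.IntegrableOn (fun t : ℝ => t ^ (a - 1 - 1) * Real.exp (-(a * t))
      - 2 * (t ^ (a - 1) * Real.exp (-(a * t)))) (Set.Ioi 0) := h1.sub h2
  refine ⟨(h12.add h3).congr_fun heq measurableSet_Ioi, ?_⟩
  rw [← MeasureTheory.setIntegral_congr_fun measurableSet_Ioi heq,
    MeasureTheory.integral_add h12 h3, MeasureTheory.integral_sub h1 h2,
    MeasureTheory.integral_const_mul, hval _ (by linarith), hval _ ha0, hval _ (by linarith)]
  have g1 : Real.Gamma (a + 1) = a * Real.Gamma a := Real.Gamma_add_one ha0.ne'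
  have g2 : Real.Gamma a = (a - 1) * Real.Gamma (a - 1) := by
    rw [← Real.Gamma_add_one (by linarith)]; congr 1; ring
  have hp : (0 : ℝ) < 1 / a := by positivity
  have p1 : (1 / a) ^ (a + 1) = (1 / a) ^ a * (1 / a) := Real.rpow_add_one hp.ne' _
  have p2 : (1 / a) ^ (a - 1) = (1 / a) ^ a / (1 / a) := Real.rpow_sub_one hp.ne' _
  rw [g1, p1, p2, g2]
  have : a - 1 ≠ 0 := by linarith
  field_simp
  ring

theorem stmt4 (η : ℝ) (hη : 0 < η) (hη2 : η < Real.sqrt 2)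
    (p : ℝ → ℝ)
    (hp : ∀ x : ℝ, x > -1 / η →
      p x = (2 : ℝ) ^ (2 / η ^ 2) * η ^ (1 - 4 / η ^ 2) / Real.Gamma (2 / η ^ 2) *
        (Real.exp (-(2 / η ^ 2) * (1 / (1 + η * x))) * (1 + η * x) ^ (-2 - 2 / η ^ 2))) :
    MeasureTheory.IntegrableOn (fun x => x ^ 2 * p x) (Set.Ioi (-1 / η)) ∧
    ∫ x in Set.Ioi (-1 / η), x ^ 2 * p x = 1 / (2 - η ^ 2) := by
  have hsq : η ^ 2 < 2 := (Real.lt_sqrt hη.le).1 hη2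
  have hsq0 : 0 < η ^ 2 := by positivity
  obtain ⟨a, hadef⟩ : ∃ a, a = 2 / η ^ 2 := ⟨_, rfl⟩
  have ha : 1 < a := by rw [hadef, lt_div_iff₀ hsq0]; linarith
  have ha0 : 0 < a := by linarith
  obtain ⟨hI, hV⟩ := stmt4_aux a ha
  have hG : 0 < Real.Gamma a := Real.Gamma_pos_of_pos ha0
  obtain ⟨C, hC⟩ : ∃ C, C = (2 : ℝ) ^ a * η ^ (1 - 4 / η ^ 2) / Real.Gamma a := ⟨_, rfl⟩
  have hCval : C = η / ((1 / a) ^ a * Real.Gamma a) := by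
    have e1 : η ^ (1 - 4 / η ^ 2) = η / (η ^ 2) ^ a := by
      have : 1 - 4 / η ^ 2 = 1 - 2 * a := by rw [hadef]; ring
      rw [this, Real.rpow_sub hη, Real.rpow_one, Real.rpow_mul hη.le]
      norm_num
    have e2 : (1 / a) ^ a = (η ^ 2) ^ a / 2 ^ a := by
      rw [← Real.div_rpow hsq0.le (by norm_num)]
      congr 1; rw [hadef]; field_simp
    rw [hC, e1, e2]
    have : 0 < (η ^ 2) ^ a := by positivity
    have : (0:ℝ) < 2 ^ a := by positivity
    field_simp
  rw [← hadef] at hp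
  rw [← hC] at hp
  have him : (fun t : ℝ => (t⁻¹ - 1) / η) '' Set.Ioi 0 = Set.Ioi (-1 / η) := by
    ext x
    simp only [Set.mem_image, Set.mem_Ioi]
    constructor
    · rintro ⟨t, ht, rfl⟩
      have : 0 < t⁻¹ := by positivity
      apply div_lt_div_of_pos_right _ hη
      linarith
    · intro hx
      have : 0 < 1 + η * x := by
        rw [div_lt_iff₀ hη] at hx; linarith
      refine ⟨(1 + η * x)⁻¹, by positivity, ?_⟩
      rw [inv_inv]; field_simp; ring
  have hder : ∀ t ∈ Set.Ioi (0:ℝ), HasDerivWithinAt (fun t : ℝ => (t⁻¹ - 1) / η)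
      (-(t ^ 2)⁻¹ / η) (Set.Ioi 0) t := fun t ht =>
    (((hasDerivAt_inv (ne_of_gt ht)).sub_const 1).div_const η).hasDerivWithinAt
  have hinj : Set.InjOn (fun t : ℝ => (t⁻¹ - 1) / η) (Set.Ioi 0) := by
    intro s _ t _ h
    have h : (s⁻¹ - 1) / η = (t⁻¹ - 1) / η := h
    rw [div_left_inj' hη.ne'] at h
    exact inv_injective (by linarith)
  have hfun : Set.EqOn
      (fun t : ℝ => C / η ^ 3 * (t ^ (a - 2) * (1 - t) ^ 2 * Real.exp (-(a * t))))
      (fun t : ℝ => |(-(t ^ 2)⁻¹ / η)| • (((t⁻¹ - 1) / η) ^ 2 * p ((t⁻¹ - 1) / η)))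
      (Set.Ioi 0) := by
    intro t ht
    have hm : (t⁻¹ - 1) / η > -1 / η := by
      have : (t⁻¹ - 1) / η ∈ Set.Ioi (-1 / η) := him ▸ Set.mem_image_of_mem _ ht
      exact this
    have ht : 0 < t := ht
    have e1 : 1 + η * ((t⁻¹ - 1) / η) = t⁻¹ := by field_simp; ring
    have e2 : |(-(t ^ 2)⁻¹ / η)| = (t ^ 2)⁻¹ / η := by
      rw [neg_div, abs_neg, abs_of_pos (by positivity)]
    have e3 : (t⁻¹) ^ (-2 - a) = t ^ (a - 2) * t ^ 4 := by
      rw [Real.inv_rpow ht.le, ← Real.rpow_neg ht.le, ← Real.rpow_add_natCast ht.ne']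
      congr 1; push_cast; ring
    have e4 : -a * (1 / t⁻¹) = -(a * t) := by rw [one_div, inv_inv]; ring
    simp only [smul_eq_mul]
    rw [hp _ hm, e1, e2, e3, e4]
    field_simp
  constructor
  · rw [← him, MeasureTheory.integrableOn_image_iff_integrableOn_abs_deriv_smul
      measurableSet_Ioi hder hinj]
    exact MeasureTheory.IntegrableOn.congr_fun (hI.const_mul _) hfun measurableSet_Ioi
  · rw [← him, MeasureTheory.integral_image_eq_integral_abs_deriv_smul
      measurableSet_Ioi hder hinj,
      ← MeasureTheory.setIntegral_congr_fun measurableSet_Ioi hfun,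
      MeasureTheory.integral_const_mul, hV, hCval]
    have h1 : 0 < (1 / a) ^ a := by positivity
    have h2 : a - 1 = (2 - η ^ 2) / η ^ 2 := by rw [hadef]; field_simp
    have h3 : 2 - η ^ 2 ≠ 0 := by linarith
    rw [h2]
    generalize (1 / a) ^ a = K at *
    field_simp
end

section
/- Let h and η be real numbers with η² < 2 and 0 < h < 2 − η². Let (μ¹_n) and (μ²_n) be real sequences satisfying μ¹_{n+1} = (1−h)·μ¹_n and μ²_{n+1} = ((1−h)² + h·η²)·μ²_n + 2·h·η·μ¹_n + h for all n. Then μ²_n tends to 1/(2 − η² − h) as n → ∞. -/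
theorem stmt10 (h η : ℝ) (hη : η ^ 2 < 2) (hh0 : 0 < h) (hh : h < 2 - η ^ 2)
    (μ1 μ2 : ℕ → ℝ)
    (h1 : ∀ n : ℕ, μ1 (n + 1) = (1 - h) * μ1 n)
    (h2 : ∀ n : ℕ, μ2 (n + 1) = ((1 - h) ^ 2 + h * η ^ 2) * μ2 n + 2 * h * η * μ1 n + h) :
    Filter.Tendsto μ2 Filter.atTop (nhds (1 / (2 - η ^ 2 - h))) := by
  have hd : 0 < 2 - η ^ 2 - h := by linarith
  set L := 1 / (2 - η ^ 2 - h) with hL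
  have hLd : L * (2 - η ^ 2 - h) = 1 := by rw [hL]; field_simp
  set a := (1 - h) ^ 2 + h * η ^ 2 with ha
  have ha0 : 0 ≤ a := by positivity
  have ha1 : a < 1 := by nlinarith [mul_pos hh0 hd]
  have hb1 : |1 - h| < 1 := by
    rw [abs_lt]; constructor <;> nlinarith [sq_nonneg η]
  obtain ⟨r, hr0, hr1, har, hbr⟩ : ∃ r : ℝ, 0 < r ∧ r < 1 ∧ a ≤ r ∧ |1 - h| ≤ r :=
    ⟨max (max a |1 - h|) (1 / 2), lt_of_lt_of_le (by norm_num) (le_max_right _ _),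
      max_lt (max_lt ha1 hb1) (by norm_num),
      (le_max_left _ _).trans (le_max_left _ _), (le_max_right _ _).trans (le_max_left _ _)⟩
  have hm : ∀ n, |μ1 n| ≤ r ^ n * |μ1 0| := by
    intro n
    induction n with
    | zero => simp
    | succ n ih =>
      rw [h1, abs_mul, pow_succ', mul_assoc]
      exact mul_le_mul hbr ih (abs_nonneg _) hr0.le
  set C := |2 * h * η| * |μ1 0| with hC
  have he : ∀ n, |μ2 (n + 1) - L| ≤ r * |μ2 n - L| + C * r ^ n := by
    intro n
    have e : μ2 (n + 1) - L = a * (μ2 n - L) + 2 * h * η * μ1 n := by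
      rw [h2, ha]; linear_combination (-h) * hLd
    rw [e]
    refine (abs_add_le _ _).trans (add_le_add ?_ ?_)
    · rw [abs_mul, abs_of_nonneg ha0]
      exact mul_le_mul_of_nonneg_right har (abs_nonneg _)
    · rw [abs_mul, hC, mul_assoc |2 * h * η|, mul_comm |μ1 0|]
      exact mul_le_mul_of_nonneg_left (hm n) (abs_nonneg _)
  have hE : ∀ n : ℕ, r * |μ2 n - L| ≤ r ^ n * |μ2 0 - L| + (n * r ^ n) * C := by
    intro n
    induction n with
    | zero => 
      have := mul_le_mul_of_nonneg_right hr1.le (abs_nonneg (μ2 0 - L))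
      simpa using this
    | succ n ih =>
      have t1 := mul_le_mul_of_nonneg_left (he n) hr0.le
      have t2 := mul_le_mul_of_nonneg_left ih hr0.le
      push_cast
      rw [pow_succ]
      linarith
  have hlim : Filter.Tendsto (fun n : ℕ => (r ^ n * |μ2 0 - L| + (n * r ^ n) * C) / r)
      Filter.atTop (nhds 0) := by
    have := (((tendsto_pow_atTop_nhds_zero_of_lt_one hr0.le hr1).mul_const |μ2 0 - L|).add
      ((tendsto_self_mul_const_pow_of_lt_one hr0.le hr1).mul_const C)).div_const r
    simpa using this
  rw [tendsto_iff_dist_tendsto_zero]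
  refine squeeze_zero (fun n => dist_nonneg) (fun n => ?_) hlim
  rw [Real.dist_eq, le_div_iff₀ hr0, mul_comm]
  exact hE n
end

section
/- Let h and η be real numbers with h > 0 and η² < 2. Then |1 − (2−η²)·h + (1 + (1/2)·η⁴)·h²| < 1 if and only if h < (2 − η²)/(1 + (1/2)·η⁴). -/
theorem stmt13 (h η : ℝ) (hh : 0 < h) (hη : η ^ 2 < 2) :
    |1 - (2 - η ^ 2) * h + (1 + 1 / 2 * η ^ 4) * h ^ 2| < 1 ↔
      h < (2 - η ^ 2) / (1 + 1 / 2 * η ^ 4) := by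
  have hpos : 0 < 1 + 1 / 2 * η ^ 4 := by positivity
  have hid : 1 - (2 - η ^ 2) * h + (1 + 1 / 2 * η ^ 4) * h ^ 2
      = (1 - h) ^ 2 + h * η ^ 2 + 1 / 2 * h ^ 2 * η ^ 4 := by ring
  have hnn : 0 ≤ 1 - (2 - η ^ 2) * h + (1 + 1 / 2 * η ^ 4) * h ^ 2 := by
    rw [hid]; positivity
  have hfac : 1 - (2 - η ^ 2) * h + (1 + 1 / 2 * η ^ 4) * h ^ 2
      = 1 - h * ((2 - η ^ 2) - h * (1 + 1 / 2 * η ^ 4)) := by ring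
  rw [abs_of_nonneg hnn, lt_div_iff₀ hpos, hfac, sub_lt_self_iff, mul_pos_iff_of_pos_left hh,
    sub_pos]
end

section
/- Let h and η be real numbers with η² < 2 and 0 < h < (2 − η²)/(1 + (1/2)·η⁴). Let (μ¹_n) and (μ²_n) be real sequences satisfying μ¹_{n+1} = (1−h)·μ¹_n and μ²_{n+1} = ((1−h)² + h·η² + (1/2)·h²·η⁴)·μ²_n + (2·h·η + h²·η³)·μ¹_n + h + (1/2)·h²·η² for all n. Then μ²_n tends to (1 + (1/2)·h·η²)/(2 − η² − h·(1 + (1/2)·η⁴)) as n → ∞. -/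
theorem aux_tendsto (r b C : ℝ) (hr0 : 0 ≤ r) (hr : r < 1) (hb : |b| < 1) (a m : ℕ → ℝ)
    (hm : ∀ n, m (n + 1) = b * m n) (ha : ∀ n, a (n + 1) = r * a n + C * m n) :
    Filter.Tendsto a Filter.atTop (nhds 0) := by
  obtain ⟨s, hs, hs1⟩ := exists_between (max_lt hr hb)
  have hrs : r ≤ max r |b| := le_max_left _ _
  have hbs : |b| ≤ max r |b| := le_max_right _ _
  set ρ := max r |b| with hρ
  have hs0 : 0 < s := by linarith
  have hd : 0 < s - ρ := by linarith
  have hM : ∀ n, |m n| ≤ |m 0| * s ^ n := by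
    intro n
    induction n with
    | zero => simp
    | succ k ih =>
      rw [hm, abs_mul, pow_succ]
      calc |b| * |m k| ≤ s * (|m 0| * s ^ k) := by gcongr; linarith
        _ = _ := by ring
  obtain ⟨M, hMd⟩ : ∃ M, M = |a 0| + |C| * |m 0| / (s - ρ) := ⟨_, rfl⟩
  have hq : 0 ≤ |C| * |m 0| / (s - ρ) := by positivity
  have hM0 : 0 ≤ M := by rw [hMd]; positivity
  have hCM : |C| * |m 0| ≤ (s - ρ) * M := by
    have : (s - ρ) * (|C| * |m 0| / (s - ρ)) = |C| * |m 0| := by field_simp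
    rw [hMd, mul_add, this]
    have : 0 ≤ (s - ρ) * |a 0| := by positivity
    linarith
  have hA : ∀ n, |a n| ≤ M * s ^ n := by
    intro n
    induction n with
    | zero => simp; linarith
    | succ k ih =>
      rw [ha]
      have hp : 0 ≤ s ^ k := by positivity
      calc |r * a k + C * m k| ≤ |r * a k| + |C * m k| := abs_add_le _ _
        _ = r * |a k| + |C| * |m k| := by rw [abs_mul, abs_mul, abs_of_nonneg hr0]
        _ ≤ ρ * (M * s ^ k) + |C| * (|m 0| * s ^ k) := by
          have := hM k
          gcongr
        _ = (ρ * M + |C| * |m 0|) * s ^ k := by ring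
        _ ≤ (s * M) * s ^ k := by gcongr; linarith
        _ = _ := by ring
  refine squeeze_zero_norm hA ?_
  simpa using (tendsto_pow_atTop_nhds_zero_of_lt_one hs0.le hs1).const_mul M

theorem stmt14 (h η : ℝ) (hη : η ^ 2 < 2) (hh0 : 0 < h)
    (hh : h < (2 - η ^ 2) / (1 + 1 / 2 * η ^ 4))
    (μ1 μ2 : ℕ → ℝ)
    (h1 : ∀ n : ℕ, μ1 (n + 1) = (1 - h) * μ1 n)
    (h2 : ∀ n : ℕ, μ2 (n + 1) = ((1 - h) ^ 2 + h * η ^ 2 + 1 / 2 * h ^ 2 * η ^ 4) * μ2 n +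
      (2 * h * η + h ^ 2 * η ^ 3) * μ1 n + h + 1 / 2 * h ^ 2 * η ^ 2) :
    Filter.Tendsto μ2 Filter.atTop
      (nhds ((1 + 1 / 2 * h * η ^ 2) / (2 - η ^ 2 - h * (1 + 1 / 2 * η ^ 4)))) := by
  rw [lt_div_iff₀ (by positivity)] at hh
  have hD : 0 < 2 - η ^ 2 - h * (1 + 1 / 2 * η ^ 4) := by linarith
  obtain ⟨L, hL⟩ : ∃ L, L = (1 + 1 / 2 * h * η ^ 2) / (2 - η ^ 2 - h * (1 + 1 / 2 * η ^ 4)) :=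
    ⟨_, rfl⟩
  have hLD : L * (2 - η ^ 2 - h * (1 + 1 / 2 * η ^ 4)) = 1 + 1 / 2 * h * η ^ 2 := by
    rw [hL, div_mul_cancel₀ _ hD.ne']
  rw [← hL]
  have hr : (1 - h) ^ 2 + h * η ^ 2 + 1 / 2 * h ^ 2 * η ^ 4 < 1 := by
    have := mul_pos hh0 hD
    linarith
  have hb : |1 - h| < 1 := by
    rw [← sq_lt_one_iff_abs_lt_one]
    have : 0 ≤ h * η ^ 2 := by positivity
    have : 0 ≤ 1 / 2 * h ^ 2 * η ^ 4 := by positivity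
    linarith
  have key := aux_tendsto _ _ (2 * h * η + h ^ 2 * η ^ 3) (by positivity) hr hb
    (fun n => μ2 n - L) μ1 h1 (by
      intro n
      simp only [h2]
      linear_combination (-h) * hLD)
  simpa using key.add_const L
end

section
/- Let (Ω, P) be a probability space, h > 0 and η real, and let X, W : Ω → ℝ be random variables such that X is integrable, W has the Gaussian distribution with mean 0 and variance h, and X and W are independent. Define F(x) = −x − (η/2)·(1+η·x), G(x) = 1+η·x, X* = X + F(X)·h + G(X)·W, and Y = X + (1/2)·(F(X) + F(X*))·h + (1/2)·(G(X) + G(X*))·W. Then Y is integrable and E[Y] = (1 − h + (1/8)·h²·(2+η²)²)·E[X] + (1/8)·η·h²·(2+η²). -/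
open MeasureTheory ProbabilityTheory

theorem stmt15 {Ω : Type*} [MeasurableSpace Ω] (P : Measure Ω) [IsProbabilityMeasure P]
    (h η : ℝ) (hh : 0 < h) (X W : Ω → ℝ)
    (hX : Integrable X P)
    (hW : Measure.map W P = gaussianReal 0 h.toNNReal)
    (hind : IndepFun X W P)
    (F G : ℝ → ℝ)
    (hF : ∀ x : ℝ, F x = -x - η / 2 * (1 + η * x))
    (hG : ∀ x : ℝ, G x = 1 + η * x)
    (Xs Y : Ω → ℝ)
    (hXs : ∀ ω, Xs ω = X ω + F (X ω) * h + G (X ω) * W ω)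
    (hY : ∀ ω, Y ω = X ω + 1 / 2 * (F (X ω) + F (Xs ω)) * h +
      1 / 2 * (G (X ω) + G (Xs ω)) * W ω) :
    Integrable Y P ∧
    ∫ ω, Y ω ∂P = (1 - h + 1 / 8 * h ^ 2 * (2 + η ^ 2) ^ 2) * ∫ ω, X ω ∂P +
      1 / 8 * η * h ^ 2 * (2 + η ^ 2) := by
  have hWm : AEMeasurable W P := by
    by_contra hn
    rw [Measure.map_of_not_aemeasurable hn] at hW
    exact IsProbabilityMeasure.ne_zero (gaussianReal 0 h.toNNReal) hW.symm
  have hmem : MemLp W 2 P := by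
    have h1 : MemLp id 2 (Measure.map W P) := by
      rw [hW]; exact memLp_id_gaussianReal' 2 (by simp)
    exact (memLp_map_measure_iff h1.1 hWm).1 h1
  have iW : Integrable W P := hmem.integrable (by norm_num)
  have iW2 : Integrable (fun ω => W ω ^ 2) P := hmem.integrable_sq
  have eW : ∫ ω, W ω ∂P = 0 := by
    have := integral_map hWm (f := fun x : ℝ => x) (by fun_prop)
    rw [hW, integral_id_gaussianReal] at this
    exact this.symm
  have eW2 : ∫ ω, W ω ^ 2 ∂P = h := by
    have h1 := integral_map hWm (f := fun x : ℝ => x ^ 2) (by fun_prop)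
    have h2 := variance_fun_id_gaussianReal (μ := 0) (v := h.toNNReal)
    rw [variance_of_integral_eq_zero (by fun_prop) integral_id_gaussianReal] at h2
    rw [hW, h2, Real.coe_toNNReal _ hh.le] at h1
    exact h1.symm
  have hind2 : IndepFun X (fun ω => W ω ^ 2) P :=
    hind.comp (φ := id) (ψ := fun x : ℝ => x ^ 2) measurable_id (by fun_prop)
  have iXW : Integrable (fun ω => X ω * W ω) P := hind.integrable_mul hX iW
  have iXW2 : Integrable (fun ω => X ω * W ω ^ 2) P := hind2.integrable_mul hX iW2
  have eXW : ∫ ω, X ω * W ω ∂P = 0 := by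
    rw [hind.integral_fun_mul_eq_mul_integral hX.1 iW.1, eW, mul_zero]
  have eXW2 : ∫ ω, X ω * W ω ^ 2 ∂P = (∫ ω, X ω ∂P) * h := by
    rw [hind2.integral_fun_mul_eq_mul_integral hX.1 iW2.1, eW2]
  obtain ⟨a, ha⟩ : ∃ a : ℝ, a = 1 + η ^ 2 / 2 := ⟨_, rfl⟩
  have hYe : Y = fun ω => (-(h * η / 2) + a * η * h ^ 2 / 4)
      + (1 - a * h + a ^ 2 * h ^ 2 / 2) * X ω
      + (1 - h * a / 2 - η ^ 2 * h / 4) * W ω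
      + (η - η * h * a) * (X ω * W ω)
      + (η / 2) * W ω ^ 2 + (η ^ 2 / 2) * (X ω * W ω ^ 2) := by
    funext ω
    rw [hY, hF, hG, hF, hG, hXs, hF, hG, ha]
    ring
  have i0 := integrable_const (μ := P) (-(h * η / 2) + a * η * h ^ 2 / 4)
  have i1 := i0.add (hX.const_mul (1 - a * h + a ^ 2 * h ^ 2 / 2))
  have i2 := i1.add (iW.const_mul (1 - h * a / 2 - η ^ 2 * h / 4))
  have i3 := i2.add (iXW.const_mul (η - η * h * a))
  have i4 := i3.add (iW2.const_mul (η / 2))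
  have i5 := i4.add (iXW2.const_mul (η ^ 2 / 2))
  refine ⟨by rw [hYe]; exact i5, ?_⟩
  rw [hYe]
  erw [integral_add i4 (iXW2.const_mul (η ^ 2 / 2)), integral_add i3 (iW2.const_mul (η / 2)),
    integral_add i2 (iXW.const_mul (η - η * h * a)),
    integral_add i1 (iW.const_mul (1 - h * a / 2 - η ^ 2 * h / 4)),
    integral_add i0 (hX.const_mul (1 - a * h + a ^ 2 * h ^ 2 / 2))]
  simp only [integral_const_mul, eW, eW2, eXW, eXW2, integral_const, probReal_univ, one_smul]
  rw [ha]
  ring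
end
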